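/- arXiv:2211.06650 — 6 statements merged into one kernel-verified Lean document; each statement's English description precedes it below -/
import Mathlib

section
/- The matrix q₁ = s·Iₙ + κF₁ satisfies the quadratic matrix equation q₁² − b₁ q₁ + c₂ = 0. (This is the degree-two homogeneous part of the full symbol equation, and identifies formula (3.9) for the principal symbol of the factorization operator Q.) -/
open Complex

/-- The matrix `F₁` from the paper, in block form: Greek (tangential) indices are
`Sum.inl a` with `a : Fin m` (where `m = n - 1`) and the last index `n` is `Sum.inr ()`. -/
noncomputable def F1mat (m : ℕ) (ξ η : Fin m → ℝ) (s : ℝ) :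
    Matrix (Fin m ⊕ Unit) (Fin m ⊕ Unit) ℂ :=
  Matrix.of fun i j =>
    match i, j with
    | Sum.inl a, Sum.inl b => ((η a * ξ b / s : ℝ) : ℂ)
    | Sum.inl a, Sum.inr _ => Complex.I * ((η a : ℝ) : ℂ)
    | Sum.inr _, Sum.inl b => Complex.I * ((ξ b : ℝ) : ℂ)
    | Sum.inr _, Sum.inr _ => -((s : ℝ) : ℂ)

/-- The matrix `b₁`, the principal symbol of the first-order tangential coefficient `B`
in the factorization `A⁻¹ 𝓛_{λ,μ} = ∂ₙ² + B ∂ₙ + C` of the Lamé operator. -/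
noncomputable def b1mat (m : ℕ) (ξ η : Fin m → ℝ) (lam mu : ℝ) :
    Matrix (Fin m ⊕ Unit) (Fin m ⊕ Unit) ℂ :=
  Matrix.of fun i j =>
    match i, j with
    | Sum.inl _, Sum.inl _ => 0
    | Sum.inl a, Sum.inr _ => Complex.I * (((lam + mu) * η a / mu : ℝ) : ℂ)
    | Sum.inr _, Sum.inl b => Complex.I * (((lam + mu) * ξ b / (lam + 2 * mu) : ℝ) : ℂ)
    | Sum.inr _, Sum.inr _ => 0

/-- The matrix `c₂`, the degree-two symbol of the tangential coefficient `C`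
in the factorization `A⁻¹ 𝓛_{λ,μ} = ∂ₙ² + B ∂ₙ + C` of the Lamé operator. -/
noncomputable def c2mat (m : ℕ) (ξ η : Fin m → ℝ) (s lam mu : ℝ) :
    Matrix (Fin m ⊕ Unit) (Fin m ⊕ Unit) ℂ :=
  Matrix.of fun i j =>
    match i, j with
    | Sum.inl a, Sum.inl b =>
        -(((s ^ 2 * (if a = b then 1 else 0) + (lam + mu) / mu * (η a * ξ b) : ℝ)) : ℂ)
    | Sum.inl _, Sum.inr _ => 0
    | Sum.inr _, Sum.inl _ => 0
    | Sum.inr _, Sum.inr _ => -((mu / (lam + 2 * mu) * s ^ 2 : ℝ) : ℂ)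

/-- `F₁` is nilpotent of order two. -/
theorem F1mat_mul_self (m : ℕ) (ξ η : Fin m → ℝ) (s : ℝ) (hs : s ≠ 0)
    (hsum : ∑ a, ξ a * η a = s ^ 2) :
    F1mat m ξ η s * F1mat m ξ η s = 0 := by
  have hs' : (s : ℂ) ≠ 0 := mod_cast hs
  have hsumC : ∑ a, (ξ a : ℂ) * η a = (s : ℂ) ^ 2 := mod_cast hsum
  ext i j
  rcases i with a | _ <;> rcases j with b | _ <;>
    simp only [Matrix.mul_apply, Fintype.sum_sum_type, F1mat, Matrix.of_apply, Matrix.zero_apply,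
      Finset.univ_unique, Finset.sum_singleton, ofReal_div, ofReal_mul]
  · have h : ∑ x, (η a : ℂ) * ξ x / s * (η x * ξ b / s) = η a * ξ b / (s * s) * s ^ 2 := by
      rw [← hsumC, Finset.mul_sum]
      exact Finset.sum_congr rfl fun x _ => by ring
    rw [h]
    field_simp
    linear_combination (η a : ℂ) * ξ b * I_sq
  · have h : ∑ x, (η a : ℂ) * ξ x / s * (I * η x) = I * η a / s * s ^ 2 := by
      rw [← hsumC, Finset.mul_sum]
      exact Finset.sum_congr rfl fun x _ => by ring
    rw [h]
    field_simp
    ring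
  · have h : ∑ x, I * (ξ x : ℂ) * (η x * ξ b / s) = I * ξ b / s * s ^ 2 := by
      rw [← hsumC, Finset.mul_sum]
      exact Finset.sum_congr rfl fun x _ => by ring
    rw [h]
    field_simp
    ring
  · have h : ∑ x, I * (ξ x : ℂ) * (I * η x) = I ^ 2 * s ^ 2 := by
      rw [← hsumC, Finset.mul_sum]
      exact Finset.sum_congr rfl fun x _ => by ring
    rw [h, I_sq]
    ring

/-- The entries of the product `b₁ F₁`. -/
theorem b1mat_mul_F1mat (m : ℕ) (ξ η : Fin m → ℝ) (s lam mu : ℝ) (hs : s ≠ 0)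
    (hsum : ∑ a, ξ a * η a = s ^ 2) :
    b1mat m ξ η lam mu * F1mat m ξ η s = Matrix.of fun i j =>
      match i, j with
      | Sum.inl a, Sum.inl b => -((lam + mu) / mu * (η a * ξ b) : ℂ)
      | Sum.inl a, Sum.inr _ => -(I * ((lam + mu) / mu * s * η a) : ℂ)
      | Sum.inr _, Sum.inl b => I * ((lam + mu) / (lam + 2 * mu) * s * ξ b : ℂ)
      | Sum.inr _, Sum.inr _ => -((lam + mu) / (lam + 2 * mu) * s ^ 2 : ℂ) := by
  have hs' : (s : ℂ) ≠ 0 := mod_cast hs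
  have hsumC : ∑ a, (ξ a : ℂ) * η a = (s : ℂ) ^ 2 := mod_cast hsum
  ext i j
  rcases i with a | _ <;> rcases j with b | _ <;>
    simp only [Matrix.mul_apply, Fintype.sum_sum_type, F1mat, b1mat, Matrix.of_apply,
      Finset.univ_unique, Finset.sum_singleton, ofReal_div, ofReal_mul, ofReal_add, ofReal_ofNat,
      zero_mul, Finset.sum_const_zero, zero_add, add_zero]
  · linear_combination ((lam : ℂ) + mu) / mu * (η a * ξ b) * I_sq
  · ring
  · have h : ∑ x, I * (((lam : ℂ) + mu) * ξ x / (lam + 2 * mu)) * (η x * ξ b / s) =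
        I * ((lam + mu) / (lam + 2 * mu)) * ξ b / s * s ^ 2 := by
      rw [← hsumC, Finset.mul_sum]
      exact Finset.sum_congr rfl fun x _ => by ring
    rw [h, pow_two, ← mul_assoc, div_mul_cancel₀ _ hs']
    ring
  · have h : ∑ x, I * (((lam : ℂ) + mu) * ξ x / (lam + 2 * mu)) * (I * η x) =
        I ^ 2 * ((lam + mu) / (lam + 2 * mu)) * s ^ 2 := by
      rw [← hsumC, Finset.mul_sum]
      exact Finset.sum_congr rfl fun x _ => by ring
    rw [h, I_sq]
    ring

/-- `q₁ = s Iₙ + κ F₁` (with `κ = (λ+μ)/(λ+3μ)`) satisfies the quadratic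
matrix equation `q₁² − b₁ q₁ + c₂ = 0` (the degree-two homogeneous part of the full
symbol equation, identifying formula (3.9) for the principal symbol of `Q`). -/
theorem q1_solves_quadratic_symbol_equation (n : ℕ) (hn : 2 ≤ n)
    (ξ η : Fin (n - 1) → ℝ) (s : ℝ) (hs : 0 < s) (hsum : ∑ a, ξ a * η a = s ^ 2)
    (lam mu : ℝ) (hmu : 0 < mu) (hlm : 0 ≤ lam + mu) :
    ((s : ℂ) • (1 : Matrix (Fin (n - 1) ⊕ Unit) (Fin (n - 1) ⊕ Unit) ℂ) +
        (((lam + mu) / (lam + 3 * mu) : ℝ) : ℂ) • F1mat (n - 1) ξ η s) *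
      ((s : ℂ) • (1 : Matrix (Fin (n - 1) ⊕ Unit) (Fin (n - 1) ⊕ Unit) ℂ) +
        (((lam + mu) / (lam + 3 * mu) : ℝ) : ℂ) • F1mat (n - 1) ξ η s)
      - b1mat (n - 1) ξ η lam mu *
        ((s : ℂ) • (1 : Matrix (Fin (n - 1) ⊕ Unit) (Fin (n - 1) ⊕ Unit) ℂ) +
          (((lam + mu) / (lam + 3 * mu) : ℝ) : ℂ) • F1mat (n - 1) ξ η s)
      + c2mat (n - 1) ξ η s lam mu = 0 := by
  have h2 : (lam : ℂ) + mu * 2 ≠ 0 := mod_cast (by linarith : 0 < lam + mu * 2).ne'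
  have h3 : (lam : ℂ) + mu * 3 ≠ 0 := mod_cast (by linarith : 0 < lam + mu * 3).ne'
  have hmu' : (mu : ℂ) ≠ 0 := mod_cast hmu.ne'
  have hs' : (s : ℂ) ≠ 0 := mod_cast hs.ne'
  simp only [mul_add, add_mul, smul_mul_assoc, mul_smul_comm, one_mul, mul_one,
    F1mat_mul_self _ ξ η s hs.ne' hsum, b1mat_mul_F1mat _ ξ η s lam mu hs.ne' hsum]
  ext i j
  rcases i with a | _ <;> rcases j with b | _ <;>
    simp only [F1mat, b1mat, c2mat, Matrix.add_apply, Matrix.sub_apply, Matrix.smul_apply,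
      Matrix.of_apply, Matrix.zero_apply, Matrix.one_apply, smul_eq_mul, Sum.inl.injEq,
      reduceCtorEq, if_true, if_false]
  · split_ifs <;> push_cast <;> field_simp <;> ring
  all_goals
    push_cast
    field_simp
    ring
end

section
/- One has the factorization of the principal symbol of the Lamé operator: (s·Iₙ + κF₂)(s·Iₙ + κF₁) = −c₂, i.e. s²Iₙ + sκ(F₁ + F₂) + κ²F₂F₁ equals the block-diagonal matrix with (α,β)-entries s²δ_{αβ} + ((λ+μ)/μ) η_αξ_β and (n,n)-entry (μ/(λ+2μ))s². -/
open Complex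

/-- The matrix `F₂` from the paper. -/
noncomputable def F2mat (m : ℕ) (ξ η : Fin m → ℝ) (s lam mu : ℝ) :
    Matrix (Fin m ⊕ Unit) (Fin m ⊕ Unit) ℂ :=
  Matrix.of fun i j =>
    match i, j with
    | Sum.inl a, Sum.inl b => ((η a * ξ b / s : ℝ) : ℂ)
    | Sum.inl a, Sum.inr _ => -(Complex.I * (((lam + 2 * mu) / mu * η a : ℝ) : ℂ))
    | Sum.inr _, Sum.inl b => -(Complex.I * ((mu / (lam + 2 * mu) * ξ b : ℝ) : ℂ))
    | Sum.inr _, Sum.inr _ => -((s : ℝ) : ℂ)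

/-- The entries of the product `F₂ F₁`. -/
lemma F2mat_mul_F1mat (m : ℕ) (ξ η : Fin m → ℝ) (s : ℝ) (hs : s ≠ 0)
    (hsum : ∑ a, ξ a * η a = s ^ 2) (lam mu : ℝ) :
    F2mat m ξ η s lam mu * F1mat m ξ η s = Matrix.fromBlocks
      (Matrix.of fun a b => (((1 + (lam + 2 * mu) / mu) * (η a * ξ b) : ℝ) : ℂ))
      (Matrix.of fun a _ => Complex.I * (((1 + (lam + 2 * mu) / mu) * (s * η a) : ℝ) : ℂ))
      (Matrix.of fun _ b => -(Complex.I * (((1 + mu / (lam + 2 * mu)) * (s * ξ b) : ℝ) : ℂ)))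
      (Matrix.of fun _ _ => (((1 + mu / (lam + 2 * mu)) * s ^ 2 : ℝ) : ℂ)) := by
  have hsC : (s : ℂ) ≠ 0 := mod_cast hs
  have hsumC : ∑ a, (ξ a : ℂ) * η a = (s : ℂ) ^ 2 := mod_cast hsum
  have factor (f : Fin m → ℂ) (c : ℂ) (hf : ∀ x, f x = c * (ξ x * η x)) :
      ∑ x, f x = c * (s : ℂ) ^ 2 := by
    rw [← hsumC, Finset.mul_sum]
    exact Finset.sum_congr rfl fun x _ => hf x
  ext (a | u) (b | v)
  · simp only [Matrix.mul_apply, Fintype.sum_sum_type, F1mat, F2mat, Matrix.of_apply,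
      Matrix.fromBlocks_apply₁₁, Finset.univ_unique, Finset.sum_singleton]
    push_cast
    rw [factor _ (η a * ξ b / s ^ 2) fun x => by ring]
    field_simp
    linear_combination (-(lam + 2 * mu) * η a * ξ b / mu : ℂ) * Complex.I_sq
  · simp only [Matrix.mul_apply, Fintype.sum_sum_type, F1mat, F2mat, Matrix.of_apply,
      Matrix.fromBlocks_apply₁₂, Finset.univ_unique, Finset.sum_singleton]
    push_cast
    rw [factor _ (Complex.I * η a / s) fun x => by ring]
    field_simp
  · simp only [Matrix.mul_apply, Fintype.sum_sum_type, F1mat, F2mat, Matrix.of_apply,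
      Matrix.fromBlocks_apply₂₁, Finset.univ_unique, Finset.sum_singleton]
    push_cast
    rw [factor _ (-(Complex.I * (mu / (lam + 2 * mu)) * ξ b / s)) fun x => by ring]
    field_simp
    ring
  · simp only [Matrix.mul_apply, Fintype.sum_sum_type, F1mat, F2mat, Matrix.of_apply,
      Matrix.fromBlocks_apply₂₂, Finset.univ_unique, Finset.sum_singleton]
    push_cast
    rw [factor _ (-(Complex.I ^ 2 * (mu / (lam + 2 * mu)))) fun x => by ring, Complex.I_sq]
    ring

/-- the factorization of the principal symbol of the Lamé operator:
`(s Iₙ + κ F₂)(s Iₙ + κ F₁) = −c₂`, with `κ = (λ+μ)/(λ+3μ)`. -/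
theorem principal_symbol_factorization (n : ℕ) (hn : 2 ≤ n)
    (ξ η : Fin (n - 1) → ℝ) (s : ℝ) (hs : 0 < s) (hsum : ∑ a, ξ a * η a = s ^ 2)
    (lam mu : ℝ) (hmu : 0 < mu) (hlm : 0 ≤ lam + mu) :
    ((s : ℂ) • (1 : Matrix (Fin (n - 1) ⊕ Unit) (Fin (n - 1) ⊕ Unit) ℂ) +
        (((lam + mu) / (lam + 3 * mu) : ℝ) : ℂ) • F2mat (n - 1) ξ η s lam mu) *
      ((s : ℂ) • (1 : Matrix (Fin (n - 1) ⊕ Unit) (Fin (n - 1) ⊕ Unit) ℂ) +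
        (((lam + mu) / (lam + 3 * mu) : ℝ) : ℂ) • F1mat (n - 1) ξ η s)
      = -(c2mat (n - 1) ξ η s lam mu) := by
  have hmuC : (mu : ℂ) ≠ 0 := mod_cast hmu.ne'
  have hsC : (s : ℂ) ≠ 0 := mod_cast hs.ne'
  have h2 : (lam + mu * 2 : ℂ) ≠ 0 := by
    have : lam + mu * 2 ≠ 0 := by linarith
    exact_mod_cast this
  have h3 : (lam + mu * 3 : ℂ) ≠ 0 := by
    have : lam + mu * 3 ≠ 0 := by linarith
    exact_mod_cast this
  simp only [add_mul, mul_add, smul_mul_smul_comm, one_mul, mul_one,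
    F2mat_mul_F1mat _ ξ η s hs.ne' hsum]
  ext (a | u) (b | v)
  · by_cases hab : a = b <;>
    · simp [F1mat, F2mat, c2mat, hab]
      field_simp
      ring
  all_goals
    simp [F1mat, F2mat, c2mat]
    field_simp
    ring
end

section
/- For every n×n complex matrix E, the matrix q = (1/(2s))·E − (1/(4s²))·(N₂E + EN₁) + (1/(4s³))·N₂EN₁ satisfies the Sylvester equation (s·I + N₂)·q + q·(s·I + N₁) = E. -/
/-- for square-zero `N₁, N₂` and `s ≠ 0`, the matrix
`q = (1/(2s)) E − (1/(4s²)) (N₂ E + E N₁) + (1/(4s³)) N₂ E N₁`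
satisfies the Sylvester equation `(s I + N₂) q + q (s I + N₁) = E`. -/
theorem sylvester_explicit_solution (n : ℕ) (hn : 1 ≤ n) (s : ℝ) (hs : s ≠ 0)
    (N₁ N₂ : Matrix (Fin n) (Fin n) ℂ) (hN₁ : N₁ * N₁ = 0) (hN₂ : N₂ * N₂ = 0)
    (E : Matrix (Fin n) (Fin n) ℂ) :
    ((s : ℂ) • (1 : Matrix (Fin n) (Fin n) ℂ) + N₂) *
        ((1 / (2 * (s : ℂ))) • E - (1 / (4 * (s : ℂ) ^ 2)) • (N₂ * E + E * N₁)
          + (1 / (4 * (s : ℂ) ^ 3)) • (N₂ * E * N₁))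
      + ((1 / (2 * (s : ℂ))) • E - (1 / (4 * (s : ℂ) ^ 2)) • (N₂ * E + E * N₁)
          + (1 / (4 * (s : ℂ) ^ 3)) • (N₂ * E * N₁)) *
        ((s : ℂ) • (1 : Matrix (Fin n) (Fin n) ℂ) + N₁) = E := by
  have hs' : (s : ℂ) ≠ 0 := by exact_mod_cast hs
  have hN₂E : N₂ * (N₂ * E) = 0 := by rw [← mul_assoc, hN₂, zero_mul]
  have hN₂EN₁ : N₂ * (N₂ * (E * N₁)) = 0 := by rw [← mul_assoc, hN₂, zero_mul]
  simp only [add_mul, mul_add, sub_mul, mul_sub, smul_mul_assoc, mul_smul_comm, one_mul, mul_one,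
    mul_assoc, hN₁, hN₂E, hN₂EN₁, mul_zero, smul_zero, add_zero]
  match_scalars <;> field_simp <;> ring
end

section
/- Every complex eigenvalue of the matrix q₁ = s·Iₙ + κF₁ equals s; that is, the spectrum of q₁ as an n×n complex matrix is the singleton {s}. (This justifies the paper's choice of q₁ as the root of the quadratic symbol equation with positive spectrum.) -/
open Complex

theorem spectrum_eq_singleton_zero_of_isNilpotent {𝕜 A : Type*} [Field 𝕜] [Ring A]
    [Nontrivial A] [Algebra 𝕜 A] {a : A} (ha : IsNilpotent a) : spectrum 𝕜 a = {0} := by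
  ext r
  rw [spectrum.mem_iff, Set.mem_singleton_iff]
  constructor
  · contrapose!
    intro hr
    rw [sub_eq_add_neg]
    exact ha.neg.isUnit_add_left_of_commute
      ((isUnit_iff_ne_zero.mpr hr).map (algebraMap 𝕜 A)) (Algebra.commutes r (-a)).symm
  · rintro rfl
    rw [map_zero, zero_sub]
    exact ha.neg.not_isUnit

theorem F1mat_eq_vecMulVec (m : ℕ) (ξ η : Fin m → ℝ) (s : ℝ) (hs : s ≠ 0) :
    F1mat m ξ η s = Matrix.vecMulVec
      (Sum.elim (fun a => (η a : ℂ)) fun _ => Complex.I * s)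
      (Sum.elim (fun b => (ξ b : ℂ) / s) fun _ => Complex.I) := by
  have hs' : (s : ℂ) ≠ 0 := by exact_mod_cast hs
  ext (a | a) (b | b)
  · simp [F1mat, Matrix.vecMulVec_apply, mul_div_assoc]
  · simp [F1mat, Matrix.vecMulVec_apply, mul_comm]
  · simp only [F1mat, Matrix.of_apply, Matrix.vecMulVec_apply, Sum.elim_inl, Sum.elim_inr]
    field_simp
  · simp only [F1mat, Matrix.of_apply, Matrix.vecMulVec_apply, Sum.elim_inr]
    linear_combination -(s : ℂ) * Complex.I_mul_I

/-- every complex eigenvalue of `q₁ = s Iₙ + κ F₁` (with `κ = (λ+μ)/(λ+3μ)`)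
equals `s`; that is, the spectrum of `q₁` as an `n × n` complex matrix is `{s}`. -/
theorem spectrum_q1_eq_singleton (n : ℕ) (hn : 2 ≤ n)
    (ξ η : Fin (n - 1) → ℝ) (s : ℝ) (hs : 0 < s) (hsum : ∑ a, ξ a * η a = s ^ 2)
    (lam mu : ℝ) (hmu : 0 < mu) (hlm : 0 ≤ lam + mu) :
    spectrum ℂ
      ((s : ℂ) • (1 : Matrix (Fin (n - 1) ⊕ Unit) (Fin (n - 1) ⊕ Unit) ℂ) +
        (((lam + mu) / (lam + 3 * mu) : ℝ) : ℂ) • F1mat (n - 1) ξ η s)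
      = {(s : ℂ)} := by
  have hnil : IsNilpotent (F1mat (n - 1) ξ η s) :=
    ⟨2, by rw [pow_two, F1mat_mul_self (n - 1) ξ η s hs.ne' hsum]⟩
  rw [← Algebra.algebraMap_eq_smul_one, ← spectrum.singleton_add_eq,
    spectrum_eq_singleton_zero_of_isNilpotent (hnil.smul _), Set.singleton_add_singleton, add_zero]
end

section
/- The matrix p₁ is Hermitian and positive semidefinite; if moreover λ + μ > 0, then p₁ is positive definite. (This expresses, at the level of the principal symbol (18), that the elastic Dirichlet-to-Neumann map Λ_{λ,μ} is a self-adjoint elliptic pseudodifferential operator of order one.) -/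
open Complex
open scoped ComplexOrder

/-- The matrix `p₁` of formula (18) in the Euclidean case (`η = ξ`), the principal symbol
of the elastic Dirichlet-to-Neumann map `Λ_{λ,μ}`; Greek (tangential) indices are
`Sum.inl a` with `a : Fin m` (where `m = n - 1`) and the last index `n` is `Sum.inr ()`. -/
noncomputable def p1mat (m : ℕ) (ξ : Fin m → ℝ) (s lam mu : ℝ) :
    Matrix (Fin m ⊕ Unit) (Fin m ⊕ Unit) ℂ :=
  Matrix.of fun i j =>
    match i, j with
    | Sum.inl a, Sum.inl b =>
        ((mu * s * (if a = b then 1 else 0)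
          + mu * (lam + mu) / ((lam + 3 * mu) * s) * (ξ a * ξ b) : ℝ) : ℂ)
    | Sum.inl a, Sum.inr _ => -(Complex.I * ((2 * mu ^ 2 / (lam + 3 * mu) * ξ a : ℝ) : ℂ))
    | Sum.inr _, Sum.inl b => Complex.I * ((2 * mu ^ 2 / (lam + 3 * mu) * ξ b : ℝ) : ℂ)
    | Sum.inr _, Sum.inr _ => ((2 * mu * (lam + 2 * mu) / (lam + 3 * mu) * s : ℝ) : ℂ)

open Matrix in
theorem p1mat_isHermitian (m : ℕ) (ξ : Fin m → ℝ) (s lam mu : ℝ) :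
    (p1mat m ξ s lam mu).IsHermitian := by
  ext i j
  rcases i with a | a <;> rcases j with b | b
  · simp only [conjTranspose_apply, p1mat, of_apply, RCLike.star_def, conj_ofReal,
      eq_comm (a := b), mul_comm (ξ b)]
  all_goals simp [p1mat]

open Matrix in
/-- The Hermitian form of `p₁` in terms of the coefficients of its blocks. -/
theorem p1mat_quadraticForm (m : ℕ) (ξ : Fin m → ℝ) (s lam mu : ℝ) (x : Fin m ⊕ Unit → ℂ) :
    star x ⬝ᵥ (p1mat m ξ s lam mu *ᵥ x) =
      ((mu * s * (∑ a, (x (Sum.inl a)).re ^ 2 + ∑ a, (x (Sum.inl a)).im ^ 2)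
        + mu * (lam + mu) / ((lam + 3 * mu) * s)
          * ((∑ a, ξ a * (x (Sum.inl a)).re) ^ 2 + (∑ a, ξ a * (x (Sum.inl a)).im) ^ 2)
        + 2 * (2 * mu ^ 2 / (lam + 3 * mu))
          * ((∑ a, ξ a * (x (Sum.inl a)).re) * (x (Sum.inr ())).im
            - (∑ a, ξ a * (x (Sum.inl a)).im) * (x (Sum.inr ())).re)
        + 2 * mu * (lam + 2 * mu) / (lam + 3 * mu) * s
          * ((x (Sum.inr ())).re ^ 2 + (x (Sum.inr ())).im ^ 2) : ℝ) : ℂ) := by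
  generalize hA : mu * (lam + mu) / ((lam + 3 * mu) * s) = A
  generalize hB : 2 * mu ^ 2 / (lam + 3 * mu) = B
  generalize hD : 2 * mu * (lam + 2 * mu) / (lam + 3 * mu) * s = D
  set w := x (Sum.inr ())
  set z : ℂ := ∑ a, (ξ a : ℂ) * x (Sum.inl a) with hz
  have hzre : z.re = ∑ a, ξ a * (x (Sum.inl a)).re := by simp [hz]
  have hzim : z.im = ∑ a, ξ a * (x (Sum.inl a)).im := by simp [hz]
  have hzc : ∑ a, (ξ a : ℂ) * star (x (Sum.inl a)) = star z := by simp [hz]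
  have hrow (a : Fin m) : (p1mat m ξ s lam mu *ᵥ x) (Sum.inl a) =
      mu * s * x (Sum.inl a) + (A * z - I * B * w) * ξ a := by
    simp only [mulVec, dotProduct, Fintype.sum_sum_type, p1mat, of_apply, hA, hB,
      Finset.univ_unique, Finset.sum_singleton]
    push_cast
    simp only [add_mul, Finset.sum_add_distrib, mul_ite, ite_mul, mul_one, mul_zero, zero_mul,
      Finset.sum_ite_eq, Finset.mem_univ, if_true, apply_ite ((↑) : ℝ → ℂ),
      ofReal_one, ofReal_zero]
    have : ∑ b, (A : ℂ) * (ξ a * ξ b) * x (Sum.inl b) = A * ξ a * z := by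
      rw [hz, Finset.mul_sum]
      exact Finset.sum_congr rfl fun b _ => by ring
    rw [this]
    change _ + _ + -(I * (B * ξ a)) * w = _
    ring
  have hlast : (p1mat m ξ s lam mu *ᵥ x) (Sum.inr ()) = I * B * z + D * w := by
    simp only [mulVec, dotProduct, Fintype.sum_sum_type, p1mat, of_apply, hB, hD,
      Finset.univ_unique, Finset.sum_singleton]
    rw [hz, Finset.mul_sum]
    congr 1
    exact Finset.sum_congr rfl fun b _ => by push_cast; ring
  have hsum : ∑ a, star (x (Sum.inl a)) * (mu * s * x (Sum.inl a) + (A * z - I * B * w) * ξ a) =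
      mu * s * ((∑ a, (x (Sum.inl a)).re ^ 2 + ∑ a, (x (Sum.inl a)).im ^ 2 : ℝ) : ℂ)
        + (A * z - I * B * w) * star z := by
    generalize A * z - I * B * w = c
    rw [← hzc, ← Finset.sum_add_distrib]
    push_cast
    rw [Finset.mul_sum, Finset.mul_sum, ← Finset.sum_add_distrib]
    refine Finset.sum_congr rfl fun a _ => ?_
    have : star (x (Sum.inl a)) * x (Sum.inl a) =
        ((x (Sum.inl a)).re ^ 2 + (x (Sum.inl a)).im ^ 2 : ℂ) := by
      apply Complex.ext <;> simp [← ofReal_pow] <;> ring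
    rw [← this]
    ring
  rw [dotProduct, Fintype.sum_sum_type]
  simp only [Finset.univ_unique, Finset.sum_singleton, Pi.star_apply, hrow]
  change _ + star w * (p1mat m ξ s lam mu *ᵥ x) (Sum.inr ()) = _
  rw [hlast, hsum, ← hzre, ← hzim]
  generalize (∑ a, (x (Sum.inl a)).re ^ 2 + ∑ a, (x (Sum.inl a)).im ^ 2) = X
  apply Complex.ext
  · simp only [RCLike.star_def, add_re, mul_re, sub_re, sub_im, mul_im, add_im, ofReal_re,
      ofReal_im, I_re, I_im, conj_re, conj_im]
    ring
  · simp only [RCLike.star_def, add_re, mul_re, sub_re, sub_im, mul_im, add_im, ofReal_re,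
      ofReal_im, I_re, I_im, conj_re, conj_im]
    ring

/-- A sum-of-squares decomposition of the Hermitian form of `p₁`. -/
theorem p1_form_eq_sum_of_squares {s lam mu : ℝ} (hs : s ≠ 0) (hl : lam + 3 * mu ≠ 0)
    (X p q u v : ℝ) :
    mu * s * X + mu * (lam + mu) / ((lam + 3 * mu) * s) * (p ^ 2 + q ^ 2)
        + 2 * (2 * mu ^ 2 / (lam + 3 * mu)) * (p * v - q * u)
        + 2 * mu * (lam + 2 * mu) / (lam + 3 * mu) * s * (u ^ 2 + v ^ 2) =
      mu / s * (s ^ 2 * X - (p ^ 2 + q ^ 2))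
        + 2 * mu * s / (lam + 3 * mu) * (lam + mu)
          * ((p / s) ^ 2 + (q / s) ^ 2 + u ^ 2 + v ^ 2)
        + 2 * mu * s / (lam + 3 * mu) * mu * ((p / s + v) ^ 2 + (q / s - u) ^ 2) := by
  obtain ⟨t, rfl⟩ : ∃ t, lam = t - 3 * mu := ⟨lam + 3 * mu, by ring⟩
  rw [sub_add_cancel] at *
  field_simp
  ring

/-- `p₁` is Hermitian and positive semidefinite; if moreover `λ + μ > 0`,
then `p₁` is positive definite (ellipticity and self-adjointness of `Λ_{λ,μ}` at the
level of the principal symbol (18)). -/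
theorem p1_hermitian_posSemidef (n : ℕ) (hn : 2 ≤ n)
    (ξ : Fin (n - 1) → ℝ) (hξ : ξ ≠ 0) (s : ℝ) (hs : s = Real.sqrt (∑ a, ξ a ^ 2))
    (lam mu : ℝ) (hmu : 0 < mu) (hlm : 0 ≤ lam + mu) :
    (p1mat (n - 1) ξ s lam mu).IsHermitian ∧
    (p1mat (n - 1) ξ s lam mu).PosSemidef ∧
    (0 < lam + mu → (p1mat (n - 1) ξ s lam mu).PosDef) := by
  have hsum : 0 < ∑ a, ξ a ^ 2 := by
    obtain ⟨a, ha⟩ := Function.ne_iff.mp hξ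
    exact Finset.sum_pos' (fun _ _ => sq_nonneg _) ⟨a, Finset.mem_univ a, sq_pos_of_ne_zero ha⟩
  have hs0 : 0 < s := hs ▸ Real.sqrt_pos.mpr hsum
  have hs2 : s ^ 2 = ∑ a, ξ a ^ 2 := by rw [hs, Real.sq_sqrt hsum.le]
  have hl : 0 < lam + 3 * mu := by linarith
  have hcs (x : Fin (n - 1) ⊕ Unit → ℂ) :
      0 ≤ s ^ 2 * (∑ a, (x (Sum.inl a)).re ^ 2 + ∑ a, (x (Sum.inl a)).im ^ 2)
        - ((∑ a, ξ a * (x (Sum.inl a)).re) ^ 2 + (∑ a, ξ a * (x (Sum.inl a)).im) ^ 2) := by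
    have h₁ := Finset.sum_mul_sq_le_sq_mul_sq Finset.univ ξ fun a => (x (Sum.inl a)).re
    have h₂ := Finset.sum_mul_sq_le_sq_mul_sq Finset.univ ξ fun a => (x (Sum.inl a)).im
    rw [hs2]
    linarith
  have hH := p1mat_isHermitian (n - 1) ξ s lam mu
  refine ⟨hH, Matrix.posSemidef_iff_dotProduct_mulVec.mpr ⟨hH, fun x => ?_⟩, fun hpos =>
    Matrix.posDef_iff_dotProduct_mulVec.mpr ⟨hH, fun x hx => ?_⟩⟩
  · rw [p1mat_quadraticForm, zero_le_real, p1_form_eq_sum_of_squares hs0.ne' hl.ne']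
    have := hcs x
    positivity
  · rw [p1mat_quadraticForm, zero_lt_real, p1_form_eq_sum_of_squares hs0.ne' hl.ne']
    have hcsx := hcs x
    set X := ∑ a, (x (Sum.inl a)).re ^ 2 + ∑ a, (x (Sum.inl a)).im ^ 2 with hX
    set p := ∑ a, ξ a * (x (Sum.inl a)).re
    set q := ∑ a, ξ a * (x (Sum.inl a)).im
    set u := (x (Sum.inr ())).re with hu
    set v := (x (Sum.inr ())).im with hv
    have h₁ : 0 ≤ mu / s * (s ^ 2 * X - (p ^ 2 + q ^ 2)) := by positivity
    have h₃ : 0 ≤ 2 * mu * s / (lam + 3 * mu) * mu * ((p / s + v) ^ 2 + (q / s - u) ^ 2) := by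
      positivity
    have hk : 0 < 2 * mu * s / (lam + 3 * mu) * (lam + mu) := by positivity
    rcases (show 0 ≤ (p / s) ^ 2 + (q / s) ^ 2 + u ^ 2 + v ^ 2 by positivity).lt_or_eq
      with hlt | heq
    · have := mul_pos hk hlt
      linarith
    have hp2 := sq_nonneg (p / s)
    have hq2 := sq_nonneg (q / s)
    have hu2 := sq_nonneg u
    have hv2 := sq_nonneg v
    have hp : p = 0 := by
      have : p / s = 0 := pow_eq_zero_iff two_ne_zero |>.mp (by linarith)
      simpa [hs0.ne'] using this
    have hq : q = 0 := by
      have : q / s = 0 := pow_eq_zero_iff two_ne_zero |>.mp (by linarith)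
      simpa [hs0.ne'] using this
    have hu0 : u = 0 := pow_eq_zero_iff two_ne_zero |>.mp (by linarith)
    have hv0 : v = 0 := pow_eq_zero_iff two_ne_zero |>.mp (by linarith)
    have hXpos : 0 < X := by
      obtain ⟨i, hi⟩ := Function.ne_iff.mp hx
      rcases i with a | a
      · have hre := Finset.single_le_sum (f := fun a => (x (Sum.inl a)).re ^ 2)
          (fun _ _ => sq_nonneg _) (Finset.mem_univ a)
        have him := Finset.single_le_sum (f := fun a => (x (Sum.inl a)).im ^ 2)
          (fun _ _ => sq_nonneg _) (Finset.mem_univ a)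
        have hpos_a := normSq_pos.mpr hi
        rw [normSq_apply, ← sq, ← sq] at hpos_a
        exact hpos_a.trans_le (add_le_add hre him)
      · exact absurd (Complex.ext hu0 hv0) hi
    rw [hp, hq, hu0, hv0]
    have : 0 < mu / s * (s ^ 2 * X) := by positivity
    simpa using this
end

section
/- If λ₁, μ₁, λ₂, μ₂ ∈ ℝ satisfy μⱼ > 0 and λⱼ + μⱼ ≥ 0 for j = 1, 2, and if 2μ₁²/(λ₁+3μ₁) = 2μ₂²/(λ₂+3μ₂) and 2μ₁(λ₁+2μ₁)/(λ₁+3μ₁) = 2μ₂(λ₂+2μ₂)/(λ₂+3μ₂), then λ₁ = λ₂ and μ₁ = μ₂. -/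
/-- The two symbol coefficients sum to twice the shear modulus. -/
theorem lame_symbol_coefficients_add {lam mu : ℝ} (h : lam + 3 * mu ≠ 0) :
    2 * mu ^ 2 / (lam + 3 * mu) + 2 * mu * (lam + 2 * mu) / (lam + 3 * mu) = 2 * mu := by
  rw [← add_div, div_eq_iff h]
  ring

/-- injectivity of the map `(λ, μ) ↦ (f₁, f₂) = (2μ²/(λ+3μ), 2μ(λ+2μ)/(λ+3μ))`
on Lamé coefficients with `μ > 0` and `λ + μ ≥ 0`: the principal symbol of the elastic
Dirichlet-to-Neumann map determines the Lamé coefficients on the boundary. -/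
theorem lame_coefficients_injective (lam₁ mu₁ lam₂ mu₂ : ℝ)
    (hmu₁ : 0 < mu₁) (hlm₁ : 0 ≤ lam₁ + mu₁) (hmu₂ : 0 < mu₂) (hlm₂ : 0 ≤ lam₂ + mu₂)
    (hf₁ : 2 * mu₁ ^ 2 / (lam₁ + 3 * mu₁) = 2 * mu₂ ^ 2 / (lam₂ + 3 * mu₂))
    (hf₂ : 2 * mu₁ * (lam₁ + 2 * mu₁) / (lam₁ + 3 * mu₁)
      = 2 * mu₂ * (lam₂ + 2 * mu₂) / (lam₂ + 3 * mu₂)) :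
    lam₁ = lam₂ ∧ mu₁ = mu₂ := by
  have h₁ : lam₁ + 3 * mu₁ ≠ 0 := (by linarith : 0 < lam₁ + 3 * mu₁).ne'
  have h₂ : lam₂ + 3 * mu₂ ≠ 0 := (by linarith : 0 < lam₂ + 3 * mu₂).ne'
  have hmu : mu₁ = mu₂ := by
    linarith [lame_symbol_coefficients_add h₁, lame_symbol_coefficients_add h₂]
  subst hmu
  rw [div_eq_div_iff h₁ h₂] at hf₁
  have hden := mul_left_cancel₀ (by positivity) hf₁
  exact ⟨by linarith, rfl⟩
end
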